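/- Let R be a commutative Noetherian local ring of Krull dimension d with maximal ideal 𝔪 and C a semidualizing R-module. Let M be a nonzero finitely generated R-module such that Ext_R^j(M,R) = 0 for all 1 ≤ j ≤ d−1 and such that M* = Hom_R(M,R) is nonzero of finite C-injective dimension. Then R is Cohen-Macaulay, C is a canonical module for R (i.e., C has finite injective dimension), and M ≅ Γ_𝔪(M) ⊕ R^r for some integer r ≥ 0. -/

import Mathlib

open CategoryTheory

noncomputable section

/-- The `i`-th Ext module of two `R`-modules. -/
def extMod (R : Type) [CommRing R] (i : ℕ) (M N : Type) [AddCommGroup M] [Module R M]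
    [AddCommGroup N] [Module R N] : ModuleCat R :=
  ((Ext R (ModuleCat R) i).obj (Opposite.op (ModuleCat.of R M))).obj (ModuleCat.of R N)

/-- The `i`-th Tor module of two `R`-modules. -/
def torMod (R : Type) [CommRing R] (i : ℕ) (M N : Type) [AddCommGroup M] [Module R M]
    [AddCommGroup N] [Module R N] : ModuleCat R :=
  ((Tor (ModuleCat R) i).obj (ModuleCat.of R M)).obj (ModuleCat.of R N)

/-- The depth of a module over a local ring: the infimum of the set of
indices `i` with `Ext^i(R/𝔪, N) ≠ 0`. -/
def moduleDepth (R : Type) [CommRing R] [IsLocalRing R] (N : Type) [AddCommGroup N]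
    [Module R N] : ℕ :=
  sInf {i : ℕ | ¬ Subsingleton (extMod R i (R ⧸ IsLocalRing.maximalIdeal R) N)}

/-- An `R`-module `N` has finite injective dimension iff there is an `n` such that
`Ext^i(M, N) = 0` for all modules `M` and all `i > n`. -/
def HasFiniteInjDim (R : Type) [CommRing R] (N : Type) [AddCommGroup N] [Module R N] : Prop :=
  ∃ n : ℕ, ∀ (M : Type) [AddCommGroup M] [Module R M], ∀ i : ℕ, n < i →
    Subsingleton (extMod R i M N)

/-- An `R`-module `M` has finite projective dimension iff there is an `n` such that
`Ext^i(M, N) = 0` for all modules `N` and all `i > n`. -/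
def HasFiniteProjDim (R : Type) [CommRing R] (M : Type) [AddCommGroup M] [Module R M] : Prop :=
  ∃ n : ℕ, ∀ (N : Type) [AddCommGroup N] [Module R N], ∀ i : ℕ, n < i →
    Subsingleton (extMod R i M N)

/-- The `𝔪`-torsion submodule `Γ_𝔪(M)` of a module over a local ring. -/
def mTorsion (R : Type) [CommRing R] [IsLocalRing R] (M : Type) [AddCommGroup M]
    [Module R M] : Submodule R M :=
  ⨆ n : ℕ, Submodule.torsionBySet R M ((IsLocalRing.maximalIdeal R ^ n : Ideal R) : Set R)

/-- A semidualizing module: the natural map `R → Hom(C,C)` is bijective and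
`Ext^i(C,C) = 0` for all `i ≥ 1`. -/
structure IsSemidualizing (R : Type) [CommRing R] (C : Type) [AddCommGroup C]
    [Module R C] : Prop where
  bijective : Function.Bijective (LinearMap.lsmul R C)
  ext_vanish : ∀ i : ℕ, 1 ≤ i → Subsingleton (extMod R i C C)

/-- Membership in the Auslander class `A_C(R)`: the natural map `M → Hom(C, C ⊗ M)` is
bijective, `Tor_i(C, M) = 0` and `Ext^i(C, C ⊗ M) = 0` for all `i ≥ 1`. -/
structure MemAuslanderClass (R : Type) [CommRing R] (C : Type) [AddCommGroup C] [Module R C]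
    (M : Type) [AddCommGroup M] [Module R M] : Prop where
  bijective : Function.Bijective ((TensorProduct.mk R C M).flip)
  tor_vanish : ∀ i : ℕ, 1 ≤ i → Subsingleton (torMod R i C M)
  ext_vanish : ∀ i : ℕ, 1 ≤ i → Subsingleton (extMod R i C (TensorProduct R C M))

/-- A module `N` is Tor-rigid if for every finitely generated module `M` and every `i ≥ 1`,
`Tor_i(M, N) = 0` implies `Tor_{i+1}(M, N) = 0`. -/
def IsTorRigid (R : Type) [CommRing R] (N : Type) [AddCommGroup N] [Module R N] : Prop :=
  ∀ (M : Type) [AddCommGroup M] [Module R M], Module.Finite R M →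
    ∀ i : ℕ, 1 ≤ i → Subsingleton (torMod R i M N) → Subsingleton (torMod R (i + 1) M N)

/-- The natural map `C ⊗ Hom(M,N) → Hom(M, C ⊗ N)`, sending `c ⊗ φ` to `m ↦ c ⊗ φ m`. -/
def homTensorMap (R : Type) [CommRing R] (C M N : Type) [AddCommGroup C] [Module R C]
    [AddCommGroup M] [Module R M] [AddCommGroup N] [Module R N] :
    TensorProduct R C (M →ₗ[R] N) →ₗ[R] (M →ₗ[R] TensorProduct R C N) :=
  TensorProduct.lift
    ((LinearMap.llcomp R M N (TensorProduct R C N)).comp (TensorProduct.mk R C N))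

section ExtOfModules

universe u

variable (R : Type u) [CommRing R]

/-- The `i`-th Ext module of two `R`-modules, computed in the derived category. -/
abbrev ExtM (i : ℕ) (M N : Type u) [AddCommGroup M] [Module R M] [AddCommGroup N] [Module R N] :
    Type u :=
  Abelian.Ext (ModuleCat.of R M) (ModuleCat.of R N) i

variable {R}
variable {A B D N P : Type u} [AddCommGroup A] [Module R A] [AddCommGroup B] [Module R B]
  [AddCommGroup D] [Module R D] [AddCommGroup N] [Module R N] [AddCommGroup P] [Module R P]

variable (N) in
/-- Functoriality of Ext in the first argument. -/
def extPre (i : ℕ) (f : A →ₗ[R] B) : ExtM R i B N →ₗ[R] ExtM R i A N where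
  toFun x := (Abelian.Ext.mk₀ (ModuleCat.ofHom f)).comp x (zero_add i)
  map_add' x y := by simp
  map_smul' r x := by simp

lemma extPre_add (i : ℕ) (f g : A →ₗ[R] B) : extPre N i (f + g) = extPre N i f + extPre N i g := by
  ext x; simp [extPre, ModuleCat.ofHom_add, Abelian.Ext.mk₀_add, Abelian.Ext.add_comp]

lemma extPre_smul (i : ℕ) (r : R) (f : A →ₗ[R] B) : extPre N i (r • f) = r • extPre N i f := by
  ext x
  have : ModuleCat.ofHom (r • f) = r • ModuleCat.ofHom f := rfl
  simp [extPre, this, Abelian.Ext.mk₀_smul]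

lemma extPre_comp (i : ℕ) (f : A →ₗ[R] B) (g : B →ₗ[R] D) :
    extPre N i (g ∘ₗ f) = extPre N i f ∘ₗ extPre N i g := by
  ext x
  exact (Abelian.Ext.mk₀_comp_mk₀_assoc (ModuleCat.ofHom f) (ModuleCat.ofHom g) x).symm

lemma extPre_id (i : ℕ) : extPre N i (LinearMap.id : A →ₗ[R] A) = LinearMap.id := by
  ext x
  simp [extPre, ModuleCat.ofHom_id]

lemma extPre_zero (i : ℕ) : extPre N i (0 : A →ₗ[R] B) = 0 := by
  ext x
  have : ModuleCat.ofHom (0 : A →ₗ[R] B) = 0 := rfl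
  simp [extPre, this]

lemma extPre_sum {ι : Type*} (s : Finset ι) (i : ℕ) (f : ι → A →ₗ[R] B) :
    extPre N i (∑ j ∈ s, f j) = ∑ j ∈ s, extPre N i (f j) := by
  classical
  induction s using Finset.induction_on with
  | empty => simp [extPre_zero]
  | insert a s ha ih => rw [Finset.sum_insert ha, Finset.sum_insert ha, extPre_add, ih]

/-- The short exact sequence of module objects attached to linear maps. -/
lemma shortExact_of_linearMap {f : A →ₗ[R] B} {g : B →ₗ[R] D} (hf : Function.Injective f)
    (hg : Function.Surjective g) (h : Function.Exact f g) :
    (ShortComplex.mk (ModuleCat.ofHom f) (ModuleCat.ofHom g)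
      (by rw [← ModuleCat.ofHom_comp, h.linearMap_comp_eq_zero]; rfl)).ShortExact where
  exact := (ShortComplex.ShortExact.moduleCat_exact_iff_function_exact _).mpr h
  mono_f := (ModuleCat.mono_iff_injective _).mpr hf
  epi_g := (ModuleCat.epi_iff_surjective _).mpr hg

variable (N) in
lemma extPre_exact {f : A →ₗ[R] B} {g : B →ₗ[R] D} (hf : Function.Injective f)
    (hg : Function.Surjective g) (h : Function.Exact f g) (i : ℕ) :
    Function.Exact (extPre N i g) (extPre N i f) := by
  intro x
  constructor
  · intro hx
    exact Abelian.Ext.contravariant_sequence_exact₂ (shortExact_of_linearMap hf hg h) _ x hx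
  · rintro ⟨y, rfl⟩
    rw [← LinearMap.comp_apply, ← extPre_comp, h.linearMap_comp_eq_zero, extPre_zero]
    rfl

variable (N) in
/-- The connecting map of the contravariant long exact sequence. -/
lemma exists_extδ {f : A →ₗ[R] B} {g : B →ₗ[R] D} (hf : Function.Injective f)
    (hg : Function.Surjective g) (h : Function.Exact f g) (i : ℕ) :
    ∃ δ : ExtM R i A N →ₗ[R] ExtM R (i + 1) D N,
      Function.Exact (extPre N i f) δ ∧ Function.Exact δ (extPre N (i + 1) g) := by
  have hS := shortExact_of_linearMap hf hg h
  refine ⟨hS.extClass.precompOfLinear R _ (add_comm 1 i), fun x ↦ ⟨fun hx ↦ ?_, ?_⟩,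
    fun x ↦ ⟨fun hx ↦ ?_, ?_⟩⟩
  · exact Abelian.Ext.contravariant_sequence_exact₁ hS _ x (add_comm 1 i) hx
  · rintro ⟨y, rfl⟩
    exact hS.extClass_comp_assoc y (h := add_comm 1 i)
  · exact Abelian.Ext.contravariant_sequence_exact₃ hS _ x hx (add_comm 1 i)
  · rintro ⟨y, rfl⟩
    exact hS.comp_extClass_assoc y (add_comm 1 i)

section Vanishing

variable {f : A →ₗ[R] B} {g : B →ₗ[R] D} {i : ℕ}

lemma subsingleton_ext_mid (hf : Function.Injective f) (hg : Function.Surjective g)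
    (h : Function.Exact f g) (hA : Subsingleton (ExtM R i A N)) (hD : Subsingleton (ExtM R i D N)) :
    Subsingleton (ExtM R i B N) := by
  refine subsingleton_of_forall_eq 0 fun x ↦ ?_
  obtain ⟨y, rfl⟩ := (extPre_exact N hf hg h i x).1 (Subsingleton.elim _ _)
  rw [Subsingleton.elim y 0, map_zero]

lemma subsingleton_ext_left (hf : Function.Injective f) (hg : Function.Surjective g)
    (h : Function.Exact f g) (hB : Subsingleton (ExtM R i B N))
    (hD : Subsingleton (ExtM R (i + 1) D N)) : Subsingleton (ExtM R i A N) := by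
  obtain ⟨δ, h1, h2⟩ := exists_extδ N hf hg h i
  refine subsingleton_of_forall_eq 0 fun x ↦ ?_
  obtain ⟨y, rfl⟩ := (h1 x).1 (Subsingleton.elim _ _)
  rw [Subsingleton.elim y 0, map_zero]

lemma subsingleton_ext_right (hf : Function.Injective f) (hg : Function.Surjective g)
    (h : Function.Exact f g) (hA : Subsingleton (ExtM R i A N))
    (hB : Subsingleton (ExtM R (i + 1) B N)) : Subsingleton (ExtM R (i + 1) D N) := by
  obtain ⟨δ, h1, h2⟩ := exists_extδ N hf hg h i
  refine subsingleton_of_forall_eq 0 fun x ↦ ?_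
  obtain ⟨y, rfl⟩ := (h2 x).1 (Subsingleton.elim _ _)
  rw [Subsingleton.elim y 0, map_zero]

lemma extPre_surjective (hf : Function.Injective f) (hg : Function.Surjective g)
    (h : Function.Exact f g) (hD : Subsingleton (ExtM R (i + 1) D N)) :
    Function.Surjective (extPre N i f) := by
  obtain ⟨δ, h1, h2⟩ := exists_extδ N hf hg h i
  exact fun x ↦ (h1 x).1 (Subsingleton.elim _ _)

lemma exists_extend (hf : Function.Injective f) (hg : Function.Surjective g)
    (h : Function.Exact f g) (hD : Subsingleton (ExtM R 1 D N)) (φ : A →ₗ[R] N) :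
    ∃ ψ : B →ₗ[R] N, ψ ∘ₗ f = φ := by
  obtain ⟨y, hy⟩ := extPre_surjective hf hg h hD (Abelian.Ext.mk₀ (ModuleCat.ofHom φ))
  obtain ⟨ψ, rfl⟩ := Abelian.Ext.addEquiv₀.symm.surjective y
  refine ⟨ψ.hom, ?_⟩
  have : Abelian.Ext.mk₀ (ModuleCat.ofHom f ≫ ψ) = Abelian.Ext.mk₀ (ModuleCat.ofHom φ) := by
    rw [← hy]
    simp [extPre]
  have := congrArg ModuleCat.Hom.hom (Abelian.Ext.addEquiv₀.symm.injective this)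
  simpa using this

lemma subsingleton_ext_covariant_right (hf : Function.Injective f) (hg : Function.Surjective g)
    (h : Function.Exact f g) (hB : Subsingleton (ExtM R i P B))
    (hA : Subsingleton (ExtM R (i + 1) P A)) : Subsingleton (ExtM R i P D) := by
  refine subsingleton_of_forall_eq 0 fun x ↦ ?_
  obtain ⟨y, rfl⟩ := Abelian.Ext.covariant_sequence_exact₃ _ (shortExact_of_linearMap hf hg h) x rfl
    (Subsingleton.elim (α := ExtM R (i + 1) P A) _ _)
  rw [Subsingleton.elim (α := ExtM R i P B) y 0]
  simp

lemma exists_lift (hf : Function.Injective f) (hg : Function.Surjective g)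
    (h : Function.Exact f g) (hA : Subsingleton (ExtM R 1 P A)) (φ : P →ₗ[R] D) :
    ∃ ψ : P →ₗ[R] B, g ∘ₗ ψ = φ := by
  obtain ⟨y, hy⟩ := Abelian.Ext.covariant_sequence_exact₃ _ (shortExact_of_linearMap hf hg h)
    (Abelian.Ext.mk₀ (ModuleCat.ofHom φ)) (zero_add 1)
    (Subsingleton.elim (α := ExtM R 1 P A) _ _)
  obtain ⟨ψ, rfl⟩ := Abelian.Ext.addEquiv₀.symm.surjective y
  refine ⟨ψ.hom, ?_⟩
  have : Abelian.Ext.mk₀ (ψ ≫ ModuleCat.ofHom g) = Abelian.Ext.mk₀ (ModuleCat.ofHom φ) := by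
    rw [← hy]
    simp
  have := congrArg ModuleCat.Hom.hom (Abelian.Ext.addEquiv₀.symm.injective this)
  simpa using this

end Vanishing

lemma subsingleton_ext_of_retract {i : ℕ} (s : A →ₗ[R] B) (r : B →ₗ[R] A) (hrs : r ∘ₗ s = .id)
    (hB : Subsingleton (ExtM R i B N)) : Subsingleton (ExtM R i A N) := by
  refine subsingleton_of_forall_eq 0 fun x ↦ ?_
  have : extPre N i s (extPre N i r x) = x := by
    rw [← LinearMap.comp_apply, ← extPre_comp, hrs, extPre_id]; rfl
  rw [← this, Subsingleton.elim (extPre N i r x) 0, map_zero]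

lemma subsingleton_ext_of_retract_covariant {i : ℕ} (s : A →ₗ[R] B) (r : B →ₗ[R] A)
    (hrs : r ∘ₗ s = .id) (hB : Subsingleton (ExtM R i P B)) : Subsingleton (ExtM R i P A) := by
  refine subsingleton_of_forall_eq 0 fun x ↦ ?_
  have : (x.comp (Abelian.Ext.mk₀ (ModuleCat.ofHom s)) (add_zero i)).comp
      (Abelian.Ext.mk₀ (ModuleCat.ofHom r)) (add_zero i) = x := by
    have : ModuleCat.ofHom s ≫ ModuleCat.ofHom r = 𝟙 _ := by
      rw [← ModuleCat.ofHom_comp, hrs]; rfl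
    simp [this]
  rw [← this, Subsingleton.elim (α := ExtM R i P B)
    (x.comp (Abelian.Ext.mk₀ (ModuleCat.ofHom s)) (add_zero i)) 0]
  simp

lemma subsingleton_ext_of_linearEquiv {i : ℕ} (e : A ≃ₗ[R] B)
    (hB : Subsingleton (ExtM R i B N)) : Subsingleton (ExtM R i A N) :=
  subsingleton_ext_of_retract e.toLinearMap e.symm.toLinearMap (by ext; simp) hB

lemma subsingleton_ext_of_linearEquiv_covariant {i : ℕ} (e : A ≃ₗ[R] B)
    (hB : Subsingleton (ExtM R i P B)) : Subsingleton (ExtM R i P A) :=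
  subsingleton_ext_of_retract_covariant e.toLinearMap e.symm.toLinearMap (by ext; simp) hB

lemma subsingleton_ext_of_subsingleton [Subsingleton A] {i : ℕ} : Subsingleton (ExtM R i A N) := by
  refine subsingleton_of_forall_eq 0 fun x ↦ ?_
  have : extPre N i (LinearMap.id : A →ₗ[R] A) x = 0 := by
    rw [Subsingleton.elim (LinearMap.id : A →ₗ[R] A) 0, extPre_zero]; rfl
  rwa [extPre_id] at this

lemma subsingleton_ext_of_projective [Module.Projective R P] {i : ℕ} :
    Subsingleton (ExtM R (i + 1) P N) := by
  have : Projective (ModuleCat.of R P) := (IsProjective.iff_projective P).1 inferInstance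
  exact subsingleton_of_forall_eq 0 fun x ↦ Abelian.Ext.eq_zero_of_projective x

lemma subsingleton_ext_zero_iff : Subsingleton (ExtM R 0 A N) ↔ Subsingleton (A →ₗ[R] N) :=
  (Abelian.Ext.addEquiv₀.trans ModuleCat.homAddEquiv).subsingleton_congr

lemma subsingleton_ext_pi {ι : Type} [Finite ι] {i : ℕ} (hA : Subsingleton (ExtM R i A N)) :
    Subsingleton (ExtM R i (ι → A) N) := by
  classical
  have := Fintype.ofFinite ι
  refine subsingleton_of_forall_eq 0 fun x ↦ ?_
  have key : (LinearMap.id : (ι → A) →ₗ[R] (ι → A)) =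
      ∑ j, LinearMap.single R (fun _ ↦ A) j ∘ₗ LinearMap.proj j := by
    ext j a k
    simp [Finset.sum_apply, Pi.single_apply]
  have : extPre N i (LinearMap.id : (ι → A) →ₗ[R] (ι → A)) x = 0 := by
    rw [key, extPre_sum, LinearMap.sum_apply]
    refine Finset.sum_eq_zero fun j _ ↦ ?_
    rw [extPre_comp, LinearMap.comp_apply, Subsingleton.elim (extPre N i _ x) 0, map_zero]
  rwa [extPre_id] at this

lemma subsingleton_ext_pi_covariant {ι : Type} [Finite ι] {i : ℕ}
    (hA : Subsingleton (ExtM R i P A)) : Subsingleton (ExtM R i P (ι → A)) := by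
  classical
  have := Fintype.ofFinite ι
  refine subsingleton_of_forall_eq 0 fun x ↦ ?_
  have key : 𝟙 (ModuleCat.of R (ι → A)) = ∑ j,
      ModuleCat.ofHom (LinearMap.proj (R := R) (φ := fun _ : ι ↦ A) j) ≫
        ModuleCat.ofHom (LinearMap.single R (fun _ ↦ A) j) := by
    ext j a k
    simp [Finset.sum_apply, Pi.single_apply, ModuleCat.hom_sum]
  rw [← Abelian.Ext.comp_mk₀_id x, key, Abelian.Ext.mk₀_sum, Abelian.Ext.comp_sum]
  refine Finset.sum_eq_zero fun j _ ↦ ?_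
  rw [← Abelian.Ext.mk₀_comp_mk₀, ← Abelian.Ext.comp_assoc_of_third_deg_zero,
    Subsingleton.elim (α := ExtM R i P A)
      (x.comp (Abelian.Ext.mk₀ (ModuleCat.ofHom (LinearMap.proj j))) (add_zero i)) 0]
  simp

end ExtOfModules

section Comparison

variable {R : Type} [CommRing R]

lemma subsingleton_extMod_iff {i : ℕ} {M N : Type} [AddCommGroup M] [Module R M]
    [AddCommGroup N] [Module R N] :
    Subsingleton (extMod R i M N) ↔ Subsingleton (ExtM R i M N) := by
  let P := projectiveResolution (ModuleCat.of R M)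
  have h1 : Subsingleton (extMod R i M N) ↔
      (P.complex.linearYonedaObj R (ModuleCat.of R N)).ExactAt i := by
    rw [HomologicalComplex.exactAt_iff_isZero_homology,
      ← (P.isoExt i (ModuleCat.of R N) (R := R)).isZero_iff, ModuleCat.isZero_iff_subsingleton]
    rfl
  rw [h1]
  obtain _ | n := i
  · rw [subsingleton_ext_zero_iff, HomologicalComplex.exactAt_iff' _ 0 0 1 (by simp) (by simp),
      ShortComplex.moduleCat_exact_iff]
    obtain ⟨q, hd, hq, hdesc⟩ : ∃ q : P.complex.X 0 ⟶ ModuleCat.of R M, P.complex.d 1 0 ≫ q = 0 ∧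
        Epi q ∧ ∀ f : P.complex.X 0 ⟶ ModuleCat.of R N, P.complex.d 1 0 ≫ f = 0 →
          ∃ φ : ModuleCat.of R M ⟶ ModuleCat.of R N, f = q ≫ φ :=
      ⟨P.π.f 0, P.complex_d_comp_π_f_zero, inferInstanceAs (Epi (P.π.f 0)),
        fun f hf ↦ ⟨P.exact₀.desc f hf, (P.exact₀.g_desc f hf).symm⟩⟩
    constructor
    · intro h
      refine subsingleton_of_forall_eq 0 fun φ ↦ ?_
      have hφ : P.complex.d 1 0 ≫ q ≫ ModuleCat.ofHom φ = 0 := by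
        rw [reassoc_of% hd, Limits.zero_comp]
      obtain ⟨g, hg⟩ := h (q ≫ ModuleCat.ofHom φ) hφ
      let g' : P.complex.X 0 ⟶ ModuleCat.of R N := g
      have hg' : P.complex.d 0 0 ≫ g' = q ≫ ModuleCat.ofHom φ := hg
      rw [P.complex.shape 0 0 (by simp), Limits.zero_comp] at hg'
      have : ModuleCat.ofHom φ = 0 := by
        rw [← cancel_epi q, ← hg', Limits.comp_zero]
      exact congrArg ModuleCat.Hom.hom this
    · intro h f hf
      obtain ⟨φ, hφ⟩ := hdesc f hf
      refine ⟨0, ?_⟩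
      have h0 : φ = 0 := ModuleCat.hom_ext (Subsingleton.elim (α := M →ₗ[R] N) _ _)
      rw [h0, Limits.comp_zero] at hφ
      rw [map_zero]
      exact hφ.symm
  · rw [HomologicalComplex.exactAt_iff' _ n (n + 1) (n + 2) (by simp) (by simp),
      ShortComplex.moduleCat_exact_iff]
    constructor
    · intro h
      refine subsingleton_of_forall_eq 0 fun x ↦ ?_
      obtain ⟨f, hf, rfl⟩ := P.extMk_surjective x (n + 2) rfl
      rw [P.extMk_eq_zero_iff f _ _ _ n rfl]
      exact h f hf
    · intro h f hf
      exact (P.extMk_eq_zero_iff f (n + 2) rfl hf n rfl).1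
        (Subsingleton.elim (α := ExtM R (n + 1) M N) _ _)

end Comparison

section InjectiveDimensionBound

universe u

open RingTheory.Sequence IsLocalRing Pointwise

variable {R : Type u} [CommRing R]

lemma extPre_lsmul (N : Type u) [AddCommGroup N] [Module R N] {A : Type u} [AddCommGroup A]
    [Module R A] (i : ℕ) (r : R) (x : ExtM R i A N) :
    extPre N i (LinearMap.lsmul R A r) x = r • x := by
  have : LinearMap.lsmul R A r = r • LinearMap.id := by ext; simp
  rw [this, extPre_smul, extPre_id]
  rfl

/-- A module generated by its maximal-ideal multiples vanishes. -/
lemma IsLocalRing.subsingleton_of_forall_mem_smul_top [IsLocalRing R] {E : Type*} [AddCommGroup E]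
    [Module R E] [Module.Finite R E]
    (h : ∀ x : E, x ∈ maximalIdeal R • (⊤ : Submodule R E)) : Subsingleton E := by
  have := Submodule.eq_bot_of_le_smul_of_le_jacobson_bot (maximalIdeal R) (⊤ : Submodule R E)
    Module.Finite.fg_top (fun x _ ↦ h x) (maximalIdeal_le_jacobson _)
  exact (Submodule.subsingleton_iff R).1 (subsingleton_of_bot_eq_top this.symm)

lemma exists_isRegular_residueField_embedding [IsNoetherianRing R] [IsLocalRing R] {d : ℕ}
    (hd : ringKrullDim R = d) :
    ∃ rs : List R, (∀ r ∈ rs, r ∈ maximalIdeal R) ∧ IsRegular R rs ∧ rs.length ≤ d ∧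
      ∃ f : (R ⧸ maximalIdeal R) →ₗ[R] (R ⧸ (Ideal.ofList rs • ⊤ : Submodule R R)),
        Function.Injective f := by
  have hbound (rs : List R) (h : IsRegular R rs) : rs.length ≤ d := by
    have hsum := ringKrullDim_add_length_eq_ringKrullDim_of_isRegular rs h
    have : Nontrivial (R ⧸ Ideal.ofList rs) := by
      rw [Ideal.Quotient.nontrivial_iff]
      intro hr
      exact h.top_ne_smul (by simp [hr])
    have h0 : 0 ≤ ringKrullDim (R ⧸ Ideal.ofList rs) := ringKrullDim_nonneg_of_nontrivial
    have h1 : (rs.length : WithBot ℕ∞) ≤ d := by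
      rw [← hd, ← hsum]
      exact le_add_of_nonneg_left h0
    exact_mod_cast h1
  by_contra! hcon
  have key (n : ℕ) : ∃ rs : List R, (∀ r ∈ rs, r ∈ maximalIdeal R) ∧ IsRegular R rs ∧
      rs.length = n := by
    induction n with
    | zero => exact ⟨[], by simp, IsRegular.nil R R, rfl⟩
    | succ n ih =>
      obtain ⟨rs, h1, h2, h3⟩ := ih
      have hsub : Subsingleton
          ((R ⧸ maximalIdeal R) →ₗ[R] (R ⧸ (Ideal.ofList rs • ⊤ : Submodule R R))) := by
        refine subsingleton_of_forall_eq 0 fun f ↦ ?_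
        by_contra hf
        have : IsSimpleModule R (R ⧸ maximalIdeal R) :=
          isSimpleModule_iff_isCoatom.2 (maximalIdeal.isMaximal R).out
        exact hcon rs h1 h2 (hbound rs h2) f ((LinearMap.injective_or_eq_zero f).resolve_right hf)
      obtain ⟨x, hx, hreg⟩ := IsSMulRegular.subsingleton_linearMap_iff.1 hsub
      rw [Ideal.annihilator_quotient] at hx
      have hmem : ∀ r ∈ rs ++ [x], r ∈ maximalIdeal R := by
        simpa [or_imp, forall_and] using ⟨h1, hx⟩
      refine ⟨rs ++ [x], hmem, ?_, by simp [h3]⟩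
      rw [isRegular_iff_isWeaklyRegular_of_subset_maximalIdeal hmem, isWeaklyRegular_append_iff]
      exact ⟨h2.toIsWeaklyRegular, (isWeaklyRegular_singleton_iff _ _).2 hreg⟩
  obtain ⟨rs, -, h2, h3⟩ := key (d + 1)
  have := hbound rs h2
  omega

variable {N : Type u} [AddCommGroup N] [Module R N]

lemma subsingleton_ext_quotient_of_isWeaklyRegular {s : ℕ} {rs : List R} {Y : Type u}
    [AddCommGroup Y] [Module R Y] (hrs : IsWeaklyRegular Y rs)
    (hY : ∀ i, s < i → Subsingleton (ExtM R i Y N)) {i : ℕ} (hi : s + rs.length < i) :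
    Subsingleton (ExtM R i (Y ⧸ (Ideal.ofList rs • ⊤ : Submodule R Y)) N) := by
  induction rs generalizing Y s with
  | nil =>
    refine subsingleton_ext_of_linearEquiv (Submodule.quotEquivOfEqBot _ ?_)
      (hY i (by simpa using hi))
    simp
  | cons r rs ih =>
    rw [isWeaklyRegular_cons_iff] at hrs
    refine subsingleton_ext_of_linearEquiv
      (Submodule.quotOfListConsSMulTopEquivQuotSMulTopInner Y r rs)
      (ih (s := s + 1) hrs.2 (fun j hj ↦ ?_) (by simp at hi; omega))
    obtain ⟨j, rfl⟩ : ∃ k, j = k + 1 := ⟨j - 1, by omega⟩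
    exact subsingleton_ext_right (f := LinearMap.lsmul R Y r)
      (g := (r • (⊤ : Submodule R Y)).mkQ) hrs.1 (Submodule.mkQ_surjective _)
      (LinearMap.exact_lsmul_mkQ_smul_top Y r) (hY j (by omega)) (hY (j + 1) (by omega))

/-- Vanishing of Ext against all finitely generated modules in one degree is detected on
the residue field, provided the next degree vanishes. -/
lemma subsingleton_ext_of_residueField [IsNoetherianRing R] [IsLocalRing R] [Module.Finite R N]
    {n : ℕ} (hn : ∀ (Y : Type u) [AddCommGroup Y] [Module R Y] [Module.Finite R Y],
      Subsingleton (ExtM R (n + 1) Y N))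
    (hk : Subsingleton (ExtM R n (R ⧸ maximalIdeal R) N))
    (Y : Type u) [AddCommGroup Y] [Module R Y] [Module.Finite R Y] :
    Subsingleton (ExtM R n Y N) := by
  refine IsNoetherianRing.induction_on_isQuotientEquivQuotientPrime R (M := Y) inferInstance
    (motive := fun Y _ _ _ ↦ Subsingleton (ExtM R n Y N))
    (fun Y _ _ _ _ ↦ subsingleton_ext_of_subsingleton) (fun Y _ _ _ p e ↦ ?_)
    (fun A _ _ _ B _ _ _ D _ _ _ f g hf hg h hA hD ↦ subsingleton_ext_mid hf hg h hA hD)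
  refine subsingleton_ext_of_linearEquiv e ?_
  by_cases hp : p.asIdeal = maximalIdeal R
  · exact hp ▸ hk
  obtain ⟨x, hx, hxp⟩ := SetLike.exists_of_lt (lt_of_le_of_ne (le_maximalIdeal p.2.ne_top) hp)
  have hinj : Function.Injective (LinearMap.lsmul R (R ⧸ p.asIdeal) x) := by
    rw [← LinearMap.ker_eq_bot, LinearMap.ker_eq_bot']
    intro y hy
    rw [LinearMap.lsmul_apply, Algebra.smul_def, mul_eq_zero] at hy
    exact hy.resolve_left fun h ↦ hxp (Ideal.Quotient.eq_zero_iff_mem.1 h)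
  have hsurj := extPre_surjective (N := N) hinj (Submodule.mkQ_surjective _)
    (LinearMap.exact_lsmul_mkQ_smul_top (R ⧸ p.asIdeal) x) (hn _)
  have : Module.Finite R (ExtM R n (R ⧸ p.asIdeal) N) := ModuleCat.finite_ext R _ _ _
  refine subsingleton_of_forall_mem_smul_top (R := R) fun y ↦ ?_
  obtain ⟨z, rfl⟩ := hsurj y
  rw [extPre_lsmul]
  exact Submodule.smul_mem_smul hx trivial

/-- If Ext into a finitely generated module vanishes in large degrees, then it vanishes in
degrees beyond the length of a suitable regular sequence. -/
lemma subsingleton_ext_of_length_lt [IsNoetherianRing R] [IsLocalRing R] [Module.Finite R N]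
    {n : ℕ} (hn : ∀ (Y : Type u) [AddCommGroup Y] [Module R Y] [Module.Finite R Y],
      ∀ i, n < i → Subsingleton (ExtM R i Y N))
    {rs : List R} (hrs : IsRegular R rs)
    {f : (R ⧸ maximalIdeal R) →ₗ[R] (R ⧸ (Ideal.ofList rs • ⊤ : Submodule R R))}
    (hf : Function.Injective f)
    (Y : Type u) [AddCommGroup Y] [Module R Y] [Module.Finite R Y] {i : ℕ}
    (hi : rs.length < i) : Subsingleton (ExtM R i Y N) := by
  have key (m : ℕ) : ∀ (Y : Type u) [AddCommGroup Y] [Module R Y] [Module.Finite R Y],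
      ∀ i, n - m < i → rs.length < i → Subsingleton (ExtM R i Y N) := by
    induction m with
    | zero => exact fun Y _ _ _ i h1 h2 ↦ hn Y i (by simpa using h1)
    | succ m ih =>
      intro Y _ _ _ i h1 h2
      refine subsingleton_ext_of_residueField
        (fun Y _ _ _ ↦ ih Y (i + 1) (by omega) (by omega)) ?_ Y
      have hE : Subsingleton (ExtM R i (R ⧸ (Ideal.ofList rs • ⊤ : Submodule R R)) N) := by
        refine subsingleton_ext_quotient_of_isWeaklyRegular (s := 0) hrs.toIsWeaklyRegular
          (fun j hj ↦ ?_) (by simpa using h2)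
        obtain ⟨j, rfl⟩ : ∃ k, j = k + 1 := ⟨j - 1, by omega⟩
        exact subsingleton_ext_of_projective
      exact subsingleton_ext_left hf (Submodule.mkQ_surjective _)
        (LinearMap.exact_map_mkQ_range f) hE (ih _ (i + 1) (by omega) (by omega))
  exact key n Y i (by omega) hi

end InjectiveDimensionBound

section Semidualizing

universe u

open IsLocalRing TensorProduct

variable {R : Type u} [CommRing R]

lemma LinearMap.exists_comp_eq_of_exact {A B D N : Type*} [AddCommGroup A] [Module R A]
    [AddCommGroup B] [Module R B] [AddCommGroup D] [Module R D] [AddCommGroup N] [Module R N]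
    {f : A →ₗ[R] B} {g : B →ₗ[R] D} (hg : Function.Surjective g) (h : Function.Exact f g)
    (φ : B →ₗ[R] N) (hφ : φ ∘ₗ f = 0) : ∃ ψ : D →ₗ[R] N, ψ ∘ₗ g = φ :=
  (LinearMap.exact_lcomp_of_exact_of_surjective N h hg φ).1 hφ

/-- A generator of a finitely generated module over a local ring is detected by a functional on any
projective cover whose restriction to relations is not a unit. -/
lemma IsLocalRing.exists_functional_of_notMem_smul_top [IsLocalRing R] {C P : Type*}
    [AddCommGroup C] [Module R C] [AddCommGroup P] [Module R P] [Module.Projective R P]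
    (p : P →ₗ[R] C) {c : C} (hc : c ∉ maximalIdeal R • (⊤ : Submodule R C)) :
    ∃ u : P →ₗ[R] R, (∀ x, p x = 0 → u x ∈ maximalIdeal R) ∧
      ∀ x, p x = c → IsUnit (u x) := by
  let : Field (R ⧸ maximalIdeal R) := Ideal.Quotient.field _
  obtain ⟨φ, hφ⟩ : ∃ φ : Module.Dual (R ⧸ maximalIdeal R)
      (C ⧸ (maximalIdeal R • (⊤ : Submodule R C))), φ (Submodule.Quotient.mk c) ≠ 0 := by
    by_contra! h
    exact hc ((Submodule.Quotient.mk_eq_zero _).1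
      ((Module.forall_dual_apply_eq_zero_iff _ _).1 h))
  obtain ⟨u, hu⟩ := Module.projective_lifting_property (maximalIdeal R).mkQ
    (φ.restrictScalars R ∘ₗ Submodule.mkQ _ ∘ₗ p) (Submodule.mkQ_surjective _)
  have hu' (x) : Ideal.Quotient.mk (maximalIdeal R) (u x) = φ (Submodule.Quotient.mk (p x)) :=
    LinearMap.congr_fun hu x
  refine ⟨u, fun x hx ↦ ?_, fun x hx ↦ ?_⟩
  · rw [← Ideal.Quotient.eq_zero_iff_mem, hu', hx]
    simp
  · rw [← notMem_maximalIdeal, ← Ideal.Quotient.eq_zero_iff_mem, hu', hx]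
    exact hφ

variable {C N K : Type u} [AddCommGroup C] [Module R C] [AddCommGroup N] [Module R N]
  [AddCommGroup K] [Module R K]

lemma subsingleton_ext_dual_free {a i : ℕ} (h : Subsingleton (ExtM R i C N)) :
    Subsingleton (ExtM R i ((Fin a → R) →ₗ[R] C) N) :=
  subsingleton_ext_of_linearEquiv ((Pi.basisFun R (Fin a)).constr R).symm (subsingleton_ext_pi h)

lemma lcomp_surjective_of_subsingleton_ext {A B D : Type u} [AddCommGroup A] [Module R A]
    [AddCommGroup B] [Module R B] [AddCommGroup D] [Module R D]
    {f : A →ₗ[R] B} {g : B →ₗ[R] D} (hf : Function.Injective f)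
    (hg : Function.Surjective g) (h : Function.Exact f g) (hD : Subsingleton (ExtM R 1 D C)) :
    Function.Surjective (f.lcomp R C) := fun φ ↦ by
  obtain ⟨ψ, hψ⟩ := exists_extend hf hg h hD φ
  exact ⟨ψ, hψ⟩

lemma subsingleton_ext_ker {a i : ℕ} {p : (Fin a → R) →ₗ[R] K} (hp : Function.Surjective p)
    (hK : Subsingleton (ExtM R (i + 2) K C)) :
    Subsingleton (ExtM R (i + 1) (LinearMap.ker p) C) :=
  subsingleton_ext_left (LinearMap.ker p).subtype_injective hp (LinearMap.exact_subtype_ker_map p)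
    subsingleton_ext_of_projective hK

/-- Vanishing of Ext from `C` passes to `C`-duals of modules with no higher Ext into `C`. -/
lemma subsingleton_ext_dual [IsNoetherianRing R] [Module.Finite R C]
    {n : ℕ} (hn : ∀ (Y : Type u) [AddCommGroup Y] [Module R Y] [Module.Finite R Y],
      ∀ i, n < i → Subsingleton (ExtM R i Y N))
    {s : ℕ} (hs : ∀ i, s < i → Subsingleton (ExtM R i C N))
    [Module.Finite R K] (hK : ∀ i, Subsingleton (ExtM R (i + 1) K C)) {i : ℕ} (hi : s < i) :
    Subsingleton (ExtM R i (K →ₗ[R] C) N) := by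
  have key (m : ℕ) : ∀ (K : Type u) [AddCommGroup K] [Module R K] [Module.Finite R K],
      (∀ i, Subsingleton (ExtM R (i + 1) K C)) → ∀ i, n - m < i → s < i →
        Subsingleton (ExtM R i (K →ₗ[R] C) N) := by
    induction m with
    | zero => exact fun K _ _ _ _ i hi _ ↦ hn _ i (by simpa using hi)
    | succ m ih =>
      intro K _ _ _ hK i h1 h2
      obtain ⟨a, p, hp⟩ := Module.Finite.exists_fin' R K
      have hex := LinearMap.exact_subtype_ker_map p
      exact subsingleton_ext_left (LinearMap.lcomp_injective_of_surjective p hp)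
        (lcomp_surjective_of_subsingleton_ext (Submodule.subtype_injective _) hp hex (hK 0))
        (LinearMap.exact_lcomp_of_exact_of_surjective C hex hp)
        (subsingleton_ext_dual_free (hs i h2))
        (ih _ (fun j ↦ subsingleton_ext_ker hp (hK (j + 1))) (i + 1) (by omega) (by omega))
  exact key n K hK i (by omega) hi

lemma smulRightₗ_eq_sum {b : ℕ} (v : (Fin b → R) →ₗ[R] R) :
    (LinearMap.smulRightₗ v : C →ₗ[R] (Fin b → R) →ₗ[R] C) =
      ∑ j, v (Pi.single j 1) • LinearMap.smulRightₗ (LinearMap.proj j) := by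
  have hv : v = ∑ j, v (Pi.single j 1) • (LinearMap.proj j : (Fin b → R) →ₗ[R] R) := by
    ext j
    simp [Pi.single_apply]
  conv_lhs => rw [hv]
  simp

/-- Two steps of a free resolution, with vanishing of the `C`-dual Ext of the second syzygy. -/
lemma exists_presentation_subsingleton_ext_dual [IsNoetherianRing R] [Module.Finite R C]
    {n : ℕ} (hn : ∀ (Y : Type u) [AddCommGroup Y] [Module R Y] [Module.Finite R Y],
      ∀ i, n < i → Subsingleton (ExtM R i Y N))
    {s : ℕ} (hs : ∀ i, s < i → Subsingleton (ExtM R i C N))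
    (hCC : ∀ i, Subsingleton (ExtM R (i + 1) C C)) :
    ∃ (a b : ℕ) (p : (Fin a → R) →ₗ[R] C) (q : (Fin b → R) →ₗ[R] LinearMap.ker p),
      Function.Surjective p ∧ Function.Surjective q ∧
      Function.Surjective ((LinearMap.ker p).subtype.lcomp R C) ∧
      Function.Surjective ((LinearMap.ker q).subtype.lcomp R C) ∧
      Subsingleton (ExtM R (s + 1) (LinearMap.ker q →ₗ[R] C) N) := by
  obtain ⟨a, p, hp⟩ := Module.Finite.exists_fin' R C
  obtain ⟨b, q, hq⟩ := Module.Finite.exists_fin' R (LinearMap.ker p)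
  have h1 (i : ℕ) : Subsingleton (ExtM R (i + 1) (LinearMap.ker p) C) :=
    subsingleton_ext_ker hp (hCC (i + 1))
  exact ⟨a, b, p, q, hp, hq,
    lcomp_surjective_of_subsingleton_ext (Submodule.subtype_injective _) hp
      (LinearMap.exact_subtype_ker_map p) (hCC 0),
    lcomp_surjective_of_subsingleton_ext (Submodule.subtype_injective _) hq
      (LinearMap.exact_subtype_ker_map q) (h1 0),
    subsingleton_ext_dual hn hs (fun i ↦ subsingleton_ext_ker hq (h1 (i + 1))) (by omega)⟩

lemma IsLocalRing.exists_notMem_smul_top [IsLocalRing R] [Module.Finite R C] [Nontrivial C] :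
    ∃ c : C, c ∉ maximalIdeal R • (⊤ : Submodule R C) := by
  by_contra! h
  exact not_subsingleton C (subsingleton_of_forall_mem_smul_top h)

/-- Finite injective dimension of `N` forces the vanishing of Ext from a semidualizing module. -/
lemma subsingleton_ext_semidualizing [IsNoetherianRing R] [IsLocalRing R] [Module.Finite R C]
    [Module.Finite R N] [Nontrivial C] (hC : Function.Bijective (LinearMap.lsmul R C))
    (hCC : ∀ i, Subsingleton (ExtM R (i + 1) C C))
    {n : ℕ} (hn : ∀ (Y : Type u) [AddCommGroup Y] [Module R Y] [Module.Finite R Y],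
      ∀ i, n < i → Subsingleton (ExtM R i Y N)) {i : ℕ} (hi : 0 < i) :
    Subsingleton (ExtM R i C N) := by
  have key (m : ℕ) : ∀ i, n - m < i → 0 < i → Subsingleton (ExtM R i C N) := by
    induction m with
    | zero => exact fun i hi _ ↦ hn _ i (by simpa using hi)
    | succ m ih =>
      intro i h1 h2
      by_cases h3 : n - m < i
      · exact ih i h3 h2
      have hs (j) (hj : i < j) : Subsingleton (ExtM R j C N) := ih j (by omega) (by omega)
      obtain ⟨a, b, p, q, hp, hq, hp', hq', hE⟩ :=
        exists_presentation_subsingleton_ext_dual hn hs hCC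
      obtain ⟨c, hc⟩ := exists_notMem_smul_top (R := R) (C := C)
      obtain ⟨u, hu, hu'⟩ := exists_functional_of_notMem_smul_top p hc
      obtain ⟨x, hx⟩ := hp c
      have hexp := LinearMap.exact_subtype_ker_map p
      have hexq := LinearMap.exact_subtype_ker_map q
      have hR : Subsingleton (ExtM R i (C →ₗ[R] C) N) := by
        obtain ⟨k, rfl⟩ : ∃ k, i = k + 1 := ⟨i - 1, by omega⟩
        exact subsingleton_ext_of_linearEquiv (LinearEquiv.ofBijective _ hC).symm
          subsingleton_ext_of_projective
      have surj1 : Function.Surjective (extPre N i (LinearMap.smulRightₗ u : C →ₗ[R] _)) := by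
        intro y
        obtain ⟨v, hv⟩ := (hu' x hx).exists_left_inv
        refine ⟨extPre N i (LinearMap.applyₗ x) (v • y), ?_⟩
        rw [← LinearMap.comp_apply, ← extPre_comp]
        have : LinearMap.applyₗ x ∘ₗ (LinearMap.smulRightₗ u : C →ₗ[R] _) =
            LinearMap.lsmul R C (u x) := by
          ext; simp
        rw [this, extPre_lsmul, smul_smul, mul_comm, hv, one_smul]
      have surj2 : Function.Surjective (extPre N i ((LinearMap.ker p).subtype.lcomp R C)) :=
        fun y ↦ (extPre_exact N (LinearMap.lcomp_injective_of_surjective p hp) hp'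
          (LinearMap.exact_lcomp_of_exact_of_surjective C hexp hp) i y).1 (Subsingleton.elim _ _)
      have surj3 : Function.Surjective (extPre N i (q.lcomp R C)) :=
        extPre_surjective (LinearMap.lcomp_injective_of_surjective q hq) hq'
          (LinearMap.exact_lcomp_of_exact_of_surjective C hexq hq) hE
      have : Module.Finite R (ExtM R i C N) := ModuleCat.finite_ext R _ _ _
      refine subsingleton_of_forall_mem_smul_top (R := R) fun y ↦ ?_
      obtain ⟨y, rfl⟩ := surj1 y
      obtain ⟨y, rfl⟩ := surj2 y
      obtain ⟨y, rfl⟩ := surj3 y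
      let v : (Fin b → R) →ₗ[R] R := u ∘ₗ (LinearMap.ker p).subtype ∘ₗ q
      have hcomp : q.lcomp R C ∘ₗ (LinearMap.ker p).subtype.lcomp R C ∘ₗ
          (LinearMap.smulRightₗ u : C →ₗ[R] _) = LinearMap.smulRightₗ v := by
        ext; simp [v]
      rw [← LinearMap.comp_apply, ← LinearMap.comp_apply, ← extPre_comp, ← extPre_comp,
        hcomp, smulRightₗ_eq_sum, extPre_sum, LinearMap.sum_apply]
      refine Submodule.sum_mem _ fun j _ ↦ ?_
      rw [extPre_smul, LinearMap.smul_apply]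
      exact Submodule.smul_mem_smul (hu _ (q _).2) trivial
  exact key n i (by omega) hi

/-- If `C ⊗ X` has finite injective dimension, then the unit `X → Hom(C, C ⊗ X)` is onto. -/
lemma tensor_unit_surjective [IsNoetherianRing R] [IsLocalRing R] [Module.Finite R C]
    {X : Type u} [AddCommGroup X] [Module R X]
    [Module.Finite R X] [Nontrivial C] (hC : Function.Bijective (LinearMap.lsmul R C))
    (hCC : ∀ i, Subsingleton (ExtM R (i + 1) C C))
    {n : ℕ} (hn : ∀ (Y : Type u) [AddCommGroup Y] [Module R Y] [Module.Finite R Y],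
      ∀ i, n < i → Subsingleton (ExtM R i Y (C ⊗[R] X))) :
    Function.Surjective (TensorProduct.mk R C X).flip := by
  rw [← LinearMap.range_eq_top, ← top_le_iff]
  refine Submodule.le_of_le_smul_of_le_jacobson_bot (I := maximalIdeal R) Module.Finite.fg_top
    (maximalIdeal_le_jacobson _) fun f _ ↦ ?_
  obtain ⟨a, b, p, q, hp, hq, hp', hq', hE⟩ := exists_presentation_subsingleton_ext_dual hn
    (s := 0) (fun i hi ↦ subsingleton_ext_semidualizing hC hCC hn hi) hCC
  obtain ⟨c, hc⟩ := exists_notMem_smul_top (R := R) (C := C)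
  obtain ⟨u, hu, hu'⟩ := exists_functional_of_notMem_smul_top p hc
  obtain ⟨x, hx⟩ := hp c
  obtain ⟨t, ht⟩ := LinearMap.rTensor_surjective X hp (f c)
  have hexp := LinearMap.exact_subtype_ker_map p
  have hexq := LinearMap.exact_subtype_ker_map q
  let Φ : ((Fin a → R) →ₗ[R] C) →ₗ[R] C ⊗[R] X :=
    f ∘ₗ LinearMap.applyₗ x - LinearMap.applyₗ t ∘ₗ LinearMap.rTensorHom X
  have hΦ : Φ ∘ₗ p.lcomp R C = 0 := by
    ext ψ
    obtain ⟨r, rfl⟩ := hC.2 ψ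
    have hr : p.lcomp R C (LinearMap.lsmul R C r) = r • p := rfl
    simp [Φ, hr, hx, ht]
  obtain ⟨Φ', hΦ'⟩ := LinearMap.exists_comp_eq_of_exact hp'
    (LinearMap.exact_lcomp_of_exact_of_surjective C hexp hp) Φ hΦ
  obtain ⟨Ψ, hΨ⟩ := exists_extend (LinearMap.lcomp_injective_of_surjective q hq) hq'
    (LinearMap.exact_lcomp_of_exact_of_surjective C hexq hq) hE Φ'
  let v : (Fin b → R) →ₗ[R] R := u ∘ₗ (LinearMap.ker p).subtype ∘ₗ q
  have hcomp : q.lcomp R C ∘ₗ (LinearMap.ker p).subtype.lcomp R C ∘ₗ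
      (LinearMap.smulRightₗ u : C →ₗ[R] _) = LinearMap.smulRightₗ v := by
    ext; simp [v]
  have h1 : Φ ∘ₗ (LinearMap.smulRightₗ u : C →ₗ[R] _) ∈
      maximalIdeal R • (⊤ : Submodule R (C →ₗ[R] C ⊗[R] X)) := by
    rw [← hΦ', ← hΨ, LinearMap.comp_assoc, LinearMap.comp_assoc, hcomp, smulRightₗ_eq_sum,
      ← LinearMap.compRight_apply R, map_sum]
    refine Submodule.sum_mem _ fun j _ ↦ ?_
    rw [map_smul]
    exact Submodule.smul_mem_smul (hu _ (q _).2) trivial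
  have h2 : Φ ∘ₗ (LinearMap.smulRightₗ u : C →ₗ[R] _) =
      u x • f - (TensorProduct.mk R C X).flip (TensorProduct.lid R X (u.rTensor X t)) := by
    have h3 (c : C) (t : (Fin a → R) ⊗[R] X) : LinearMap.rTensor X (u.smulRight c) t =
        c ⊗ₜ (TensorProduct.lid R X (u.rTensor X t)) := by
      induction t with
      | zero => simp
      | add x y hx hy => simp [hx, hy, tmul_add]
      | tmul y z => simp [smul_tmul]
    ext c
    simp [Φ, h3]
  obtain ⟨w, hw⟩ := (hu' x hx).exists_left_inv
  have h4 : f = w • ((TensorProduct.mk R C X).flip (TensorProduct.lid R X (u.rTensor X t)) +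
      Φ ∘ₗ (LinearMap.smulRightₗ u : C →ₗ[R] _)) := by
    rw [h2, add_sub_cancel, smul_smul, hw, one_smul]
  rw [h4]
  exact Submodule.smul_mem _ _ (Submodule.add_mem_sup ⟨_, rfl⟩ h1)

end Semidualizing

section SplittingDual

universe u

open IsLocalRing TensorProduct

variable {R : Type u} [CommRing R] {C : Type u} [AddCommGroup C] [Module R C]

lemma subsingleton_of_subsingleton_hom_semidualizing [IsNoetherianRing R] [Module.Finite R C]
    (hC : Function.Injective (LinearMap.lsmul R C)) {T : Type*} [AddCommGroup T] [Module R T]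
    [Module.Finite R T] (h : Subsingleton (C →ₗ[R] T)) : Subsingleton T := by
  obtain ⟨r, hr, hreg⟩ := IsSMulRegular.subsingleton_linearMap_iff.1 h
  have hr0 : r = 0 := by
    apply hC
    ext c
    simpa using Module.mem_annihilator.1 hr c
  subst hr0
  exact subsingleton_of_forall_eq 0 fun t ↦ hreg (by simp)

/-- For a homothety module `C`, functionals on `M` are the same as maps `C → Hom(M, C)`. -/
lemma smulRightₗ_bijective (hC : Function.Bijective (LinearMap.lsmul R C)) (M : Type*)
    [AddCommGroup M] [Module R M] :
    Function.Bijective (LinearMap.smulRightₗ : (M →ₗ[R] R) →ₗ[R] C →ₗ[R] M →ₗ[R] C) := by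
  let e := LinearEquiv.ofBijective _ hC
  constructor
  · intro f g hfg
    ext m
    apply hC.1
    ext c
    simpa using LinearMap.congr_fun (LinearMap.congr_fun hfg c) m
  · intro g
    refine ⟨e.symm.toLinearMap ∘ₗ g.flip, ?_⟩
    ext c m
    have : e (e.symm (g.flip m)) c = g c m := by rw [e.apply_symm_apply]; rfl
    exact this

lemma LinearMap.exists_comp_eq_of_range_le {A B D : Type*} [AddCommGroup A] [Module R A]
    [AddCommGroup B] [Module R B] [AddCommGroup D] [Module R D] {f : A →ₗ[R] B}
    (hf : Function.Injective f) (g : D →ₗ[R] B) (h : ∀ x, g x ∈ LinearMap.range f) :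
    ∃ k : D →ₗ[R] A, f ∘ₗ k = g := by
  refine ⟨(LinearEquiv.ofInjective f hf).symm.toLinearMap ∘ₗ g.codRestrict _ h, ?_⟩
  ext x
  have := (LinearEquiv.ofInjective f hf).apply_symm_apply (g.codRestrict _ h x)
  exact congrArg Subtype.val this

variable {N : Type u} [AddCommGroup N] [Module R N]

lemma injective_of_compRight_injective [IsNoetherianRing R] [Module.Finite R C]
    (hC : Function.Injective (LinearMap.lsmul R C)) {Q H : Type*} [AddCommGroup Q] [Module R Q]
    [Module.Finite R Q] [AddCommGroup H] [Module R H] (φ : Q →ₗ[R] H)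
    (hφ : Function.Injective (LinearMap.compRight R φ : (C →ₗ[R] Q) →ₗ[R] _)) :
    Function.Injective φ := by
  have : Subsingleton (LinearMap.ker φ) := by
    refine subsingleton_of_subsingleton_hom_semidualizing hC
      (subsingleton_of_forall_eq 0 fun g ↦ ?_)
    have : (LinearMap.ker φ).subtype ∘ₗ g = 0 := by
      apply hφ
      ext c
      simp
    ext c
    exact LinearMap.congr_fun this c
  rw [← LinearMap.ker_eq_bot, Submodule.eq_bot_of_subsingleton (p := LinearMap.ker φ)]

/-- The syzygy comparison: an approximation `Q → Hom(M, C)` that becomes bijective after applying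
`Hom(C, -)` embeds in the dual of a free cover of `M`, with controlled Ext of the cokernel. -/
lemma injective_and_subsingleton_ext_cokernel [IsNoetherianRing R] [Module.Finite R C]
    (hC : Function.Bijective (LinearMap.lsmul R C))
    (hCC : ∀ i, Subsingleton (ExtM R (i + 1) C C))
    (hCN : ∀ i, Subsingleton (ExtM R (i + 1) C N))
    {n : ℕ} (hn : ∀ (Y : Type u) [AddCommGroup Y] [Module R Y] [Module.Finite R Y],
      ∀ i, n < i → Subsingleton (ExtM R i Y N)) (k : ℕ) :
    ∀ (M Q : Type u) [AddCommGroup M] [Module R M] [AddCommGroup Q] [Module R Q]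
      [Module.Finite R M] [Module.Finite R Q]
      (_ : ∀ j, 1 ≤ j → j ≤ k - 1 → Subsingleton (ExtM R j M R))
      (_ : ∀ i, Subsingleton (ExtM R (i + 1) C Q))
      (φ : Q →ₗ[R] M →ₗ[R] C)
      (_ : Function.Injective (LinearMap.compRight R φ : (C →ₗ[R] Q) →ₗ[R] _))
      (_ : 1 ≤ k → Function.Surjective (LinearMap.compRight R φ : (C →ₗ[R] Q) →ₗ[R] _))
      (a : ℕ) (p : (Fin a → R) →ₗ[R] M) (_ : Function.Surjective p),
      Function.Injective φ ∧ ∀ i, 1 ≤ i → n < i + k →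
        Subsingleton (ExtM R i (((Fin a → R) →ₗ[R] C) ⧸ LinearMap.range (p.lcomp R C ∘ₗ φ)) N) := by
  induction k with
  | zero =>
    intro M Q _ _ _ _ _ _ hM hQ φ hφi hφs a p hp
    exact ⟨injective_of_compRight_injective hC.1 φ hφi, fun i h1 h2 ↦ hn _ i h2⟩
  | succ k ih =>
    intro M Q _ _ _ _ _ _ hM hQ φ hφi hφs a p hp
    have hφ := injective_of_compRight_injective hC.1 φ hφi
    refine ⟨hφ, fun i h1 h2 ↦ ?_⟩
    have hexp := LinearMap.exact_subtype_ker_map p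
    have hpi : Function.Injective (p.lcomp R C) := LinearMap.lcomp_injective_of_surjective p hp
    have hpe := LinearMap.exact_lcomp_of_exact_of_surjective C hexp hp
    set j := p.lcomp R C ∘ₗ φ with hj_def
    have hj : Function.Injective j := hpi.comp hφ
    have hje : Function.Exact j (LinearMap.range j).mkQ := LinearMap.exact_map_mkQ_range j
    have hjs : Function.Surjective (LinearMap.range j).mkQ := Submodule.mkQ_surjective _
    have hF (i : ℕ) : Subsingleton (ExtM R (i + 1) C ((Fin a → R) →ₗ[R] C)) :=
      subsingleton_ext_of_linearEquiv_covariant ((Pi.basisFun R (Fin a)).constr R).symm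
        (subsingleton_ext_pi_covariant (hCC i))
    have hQ1 (i : ℕ) : Subsingleton (ExtM R (i + 1) C (_ ⧸ LinearMap.range j)) :=
      subsingleton_ext_covariant_right hj hjs hje (hF i) (hQ (i + 1))
    let φ' : (((Fin a → R) →ₗ[R] C) ⧸ LinearMap.range j) →ₗ[R] LinearMap.ker p →ₗ[R] C :=
      (LinearMap.range j).liftQ ((LinearMap.ker p).subtype.lcomp R C) (by
        rintro _ ⟨x, rfl⟩
        exact (hpe _).2 ⟨_, rfl⟩)
    have hφ' : φ' ∘ₗ (LinearMap.range j).mkQ = (LinearMap.ker p).subtype.lcomp R C :=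
      Submodule.liftQ_mkQ _ _ _
    have hφ'i : Function.Injective (LinearMap.compRight R φ' : (C →ₗ[R] _) →ₗ[R] _) := by
      rw [← LinearMap.ker_eq_bot, LinearMap.ker_eq_bot']
      intro g hg
      obtain ⟨g, rfl⟩ := exists_lift hj hjs hje (hQ 0) g
      rw [LinearMap.compRight_apply, ← LinearMap.comp_assoc, hφ'] at hg
      obtain ⟨g, rfl⟩ := LinearMap.exists_comp_eq_of_range_le hpi g fun x ↦
        (hpe _).1 (LinearMap.congr_fun hg x)
      obtain ⟨g, rfl⟩ := hφs (by omega) g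
      ext c
      exact (Submodule.Quotient.mk_eq_zero _).2 ⟨g c, rfl⟩
    have hφ's (hk : 1 ≤ k) :
        Function.Surjective (LinearMap.compRight R φ' : (C →ₗ[R] _) →ₗ[R] _) := by
      intro g
      obtain ⟨v, rfl⟩ := (smulRightₗ_bijective hC _).2 g
      obtain ⟨u, rfl⟩ := exists_extend (Submodule.subtype_injective _) hp hexp
        (hM 1 le_rfl (by omega)) v
      refine ⟨(LinearMap.range j).mkQ ∘ₗ LinearMap.smulRightₗ u, ?_⟩
      rw [LinearMap.compRight_apply, ← LinearMap.comp_assoc, hφ']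
      ext
      simp
    obtain ⟨b, q, hq⟩ := Module.Finite.exists_fin' R (LinearMap.ker p)
    obtain ⟨hinj, hE⟩ := ih (LinearMap.ker p) _ (fun l h3 h4 ↦ by
      obtain ⟨l, rfl⟩ : ∃ m, l = m + 1 := ⟨l - 1, by omega⟩
      exact subsingleton_ext_ker hp (hM (l + 2) (by omega) (by omega))) hQ1 φ' hφ'i hφ's b q hq
    obtain ⟨i, rfl⟩ : ∃ m, i = m + 1 := ⟨i - 1, by omega⟩
    have hqi : Function.Injective (q.lcomp R C) := LinearMap.lcomp_injective_of_surjective q hq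
    exact subsingleton_ext_left (f := q.lcomp R C ∘ₗ φ') (hqi.comp hinj)
      (Submodule.mkQ_surjective _) (LinearMap.exact_map_mkQ_range _)
      (subsingleton_ext_dual_free (hCN i)) (hE (i + 2) (by omega) (by omega))

/-- If `C ⊗ M*` has injective dimension at most `d` and `Ext^j(M, R) = 0` for `1 ≤ j ≤ d - 1`,
then the dual of every finite free cover of `M` splits. -/
lemma exists_retraction_lcomp [IsNoetherianRing R] [IsLocalRing R] [Module.Finite R C]
    [Nontrivial C] (hC : Function.Bijective (LinearMap.lsmul R C))
    (hCC : ∀ i, Subsingleton (ExtM R (i + 1) C C))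
    {M : Type u} [AddCommGroup M] [Module R M] [Module.Finite R M] {d : ℕ}
    (hM : ∀ j, 1 ≤ j → j ≤ d - 1 → Subsingleton (ExtM R j M R))
    (hd : ∀ (Y : Type u) [AddCommGroup Y] [Module R Y] [Module.Finite R Y],
      ∀ i, d < i → Subsingleton (ExtM R i Y (C ⊗[R] (M →ₗ[R] R))))
    {a : ℕ} (p : (Fin a → R) →ₗ[R] M) (hp : Function.Surjective p) :
    ∃ σ : ((Fin a → R) →ₗ[R] R) →ₗ[R] M →ₗ[R] R, σ ∘ₗ p.lcomp R R = .id := by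
  let η := (TensorProduct.mk R C (M →ₗ[R] R)).flip
  let φ : C ⊗[R] (M →ₗ[R] R) →ₗ[R] M →ₗ[R] C := TensorProduct.lift LinearMap.smulRightₗ.flip
  have hη : Function.Surjective η := tensor_unit_surjective hC hCC hd
  have hφη : (LinearMap.compRight R φ : (C →ₗ[R] _) →ₗ[R] _) ∘ₗ η = LinearMap.smulRightₗ := by
    ext; simp [φ, η]
  have hsm := smulRightₗ_bijective hC M
  have hηi : Function.Injective η := by
    refine Function.Injective.of_comp (f := LinearMap.compRight R φ) ?_
    rw [← LinearMap.coe_comp, hφη]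
    exact hsm.1
  have hφi : Function.Injective (LinearMap.compRight R φ : (C →ₗ[R] _) →ₗ[R] _) := by
    refine Function.Injective.of_comp_right (g := η) ?_ hη
    rw [← LinearMap.coe_comp, hφη]
    exact hsm.1
  have hφs : Function.Surjective (LinearMap.compRight R φ : (C →ₗ[R] _) →ₗ[R] _) := by
    refine Function.Surjective.of_comp (g := η) ?_
    rw [← LinearMap.coe_comp, hφη]
    exact hsm.2
  have hCN (i : ℕ) : Subsingleton (ExtM R (i + 1) C (C ⊗[R] (M →ₗ[R] R))) :=
    subsingleton_ext_semidualizing hC hCC hd i.succ_pos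
  obtain ⟨hinj, hE⟩ := injective_and_subsingleton_ext_cokernel hC hCC hCN hd d M _ hM hCN φ hφi
    (fun _ ↦ hφs) a p hp
  obtain ⟨ρ, hρ⟩ := exists_extend (f := p.lcomp R C ∘ₗ φ)
    ((LinearMap.lcomp_injective_of_surjective p hp).comp hinj)
    (Submodule.mkQ_surjective _) (LinearMap.exact_map_mkQ_range _) (hE 1 le_rfl (by omega))
    LinearMap.id
  let e := LinearEquiv.ofBijective η ⟨hηi, hη⟩
  let σ : ((Fin a → R) →ₗ[R] R) →ₗ[R] M →ₗ[R] R :=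
    e.symm.toLinearMap ∘ₗ LinearMap.compRight R ρ ∘ₗ LinearMap.smulRightₗ
  refine ⟨σ, ?_⟩
  ext1 v
  have h1 : LinearMap.compRight R ρ (LinearMap.smulRightₗ (p.lcomp R R v)) = e v := by
    ext c
    have := LinearMap.congr_fun hρ (c ⊗ₜ v)
    have h2 : p.lcomp R C (φ (c ⊗ₜ v)) = LinearMap.smulRightₗ (p.lcomp R R v) c := by
      ext; simp [φ]
    rw [LinearMap.comp_apply, LinearMap.comp_apply, h2] at this
    exact this
  change e.symm (LinearMap.compRight R ρ (LinearMap.smulRightₗ (p.lcomp R R v))) = v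
  rw [h1, e.symm_apply_apply]

/-- A module is a retract of its tensor product with a nonzero finite free module. -/
lemma exists_retract_tensor_of_free (C : Type*) [AddCommGroup C] [Module R C] {X : Type*}
    [AddCommGroup X] [Module R X] [Module.Free R X] [Nontrivial X] :
    ∃ (s : C →ₗ[R] C ⊗[R] X) (r : C ⊗[R] X →ₗ[R] C), r ∘ₗ s = .id := by
  have := Module.nontrivial R X
  let B := Module.Free.chooseBasis R X
  obtain ⟨k⟩ := B.index_nonempty
  refine ⟨(TensorProduct.mk R C X).flip (B k),
    (TensorProduct.rid R C).toLinearMap ∘ₗ (B.coord k).lTensor C, ?_⟩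
  ext; simp

lemma Module.Dual.eval_surjective_of_retraction {M : Type*} [AddCommGroup M] [Module R M]
    {a : ℕ} {p : (Fin a → R) →ₗ[R] M} {σ : ((Fin a → R) →ₗ[R] R) →ₗ[R] M →ₗ[R] R}
    (hσ : σ ∘ₗ p.lcomp R R = .id) : Function.Surjective (Module.Dual.eval R M) := by
  intro θ
  obtain ⟨v, hv⟩ := (Module.evalEquiv R (Fin a → R)).surjective (θ ∘ₗ σ)
  refine ⟨p v, ?_⟩
  ext ξ
  have h1 : ξ (p v) = θ (σ (ξ ∘ₗ p)) := LinearMap.congr_fun hv (ξ ∘ₗ p)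
  have h2 : σ (ξ ∘ₗ p) = ξ := LinearMap.congr_fun hσ ξ
  rw [Module.Dual.eval_apply, h1, h2]

end SplittingDual

section BassSupport

universe u

open IsLocalRing RingTheory.Sequence Pointwise

variable {R : Type u} [CommRing R] {N : Type u} [AddCommGroup N] [Module R N]

lemma Module.notMem_support_of_exact {A B D : Type*} [AddCommGroup A] [Module R A]
    [AddCommGroup B] [Module R B] [AddCommGroup D] [Module R D] {f : A →ₗ[R] B} {g : B →ₗ[R] D}
    (h : Function.Exact f g) {q : PrimeSpectrum R} (hA : q ∉ Module.support R A)
    (hD : q ∉ Module.support R D) : q ∉ Module.support R B := by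
  rw [Module.notMem_support_iff'] at *
  intro b
  obtain ⟨r, hr, hrb⟩ := hD (g b)
  obtain ⟨a, ha⟩ := (h (r • b)).1 (by rw [map_smul, hrb])
  obtain ⟨s, hs, hsa⟩ := hA a
  exact ⟨s * r, q.2.mul_notMem hs hr, by rw [mul_smul, ← ha, ← map_smul, hsa, map_zero]⟩

lemma support_ext_subset_of_linearEquiv {A B : Type u} [AddCommGroup A] [Module R A]
    [AddCommGroup B] [Module R B] (e : A ≃ₗ[R] B) (i : ℕ) :
    Module.support R (ExtM R i A N) ⊆ Module.support R (ExtM R i B N) := by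
  refine Module.support_subset_of_injective (extPre N i e.symm.toLinearMap) ?_
  refine Function.LeftInverse.injective (g := extPre N i e.toLinearMap) fun x ↦ ?_
  rw [← LinearMap.comp_apply, ← extPre_comp]
  simp [extPre_id]

lemma annihilator_le_of_mem_support_ext {A : Type u} [AddCommGroup A] [Module R A] {i : ℕ}
    {q : PrimeSpectrum R} (hq : q ∈ Module.support R (ExtM R i A N)) :
    Module.annihilator R A ≤ q.asIdeal := by
  refine le_trans (fun r hr ↦ Module.mem_annihilator.2 fun x ↦ ?_)
    (Module.annihilator_le_of_mem_support hq)
  have h0 : LinearMap.lsmul R A r = 0 := by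
    ext a
    exact Module.mem_annihilator.1 hr a
  rw [← extPre_lsmul, h0, extPre_zero, LinearMap.zero_apply]

lemma mem_support_ext_quotient_prime [IsNoetherianRing R] {q : PrimeSpectrum R} {i : ℕ}
    (Y : Type u) [AddCommGroup Y] [Module R Y] [Module.Finite R Y]
    (hY : ∀ p ∈ Module.support R Y, p ≤ q → p = q)
    (hq : q ∈ Module.support R (ExtM R i Y N)) :
    q ∈ Module.support R (ExtM R i (R ⧸ q.asIdeal) N) := by
  by_contra hcon
  revert hq hY
  refine IsNoetherianRing.induction_on_isQuotientEquivQuotientPrime R (M := Y) inferInstance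
    (motive := fun Y _ _ _ ↦ (∀ p ∈ Module.support R Y, p ≤ q → p = q) →
      q ∉ Module.support R (ExtM R i Y N)) (fun Y _ _ _ _ _ ↦ ?_) (fun Y _ _ _ p e hY hq ↦ ?_)
    (fun A _ _ _ B _ _ _ D _ _ _ f g hf hg h hA hD hB ↦ ?_)
  · have : Subsingleton (ExtM R i Y N) := subsingleton_ext_of_subsingleton
    simp [Module.support_eq_empty]
  · have hp : p ∈ Module.support R Y := by
      rw [e.support_eq, Module.mem_support_iff_of_finite, Ideal.annihilator_quotient]
    have hq' := support_ext_subset_of_linearEquiv e i hq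
    have hle := annihilator_le_of_mem_support_ext hq'
    rw [Ideal.annihilator_quotient] at hle
    obtain rfl := hY p hp hle
    exact hcon hq'
  · exact Module.notMem_support_of_exact (extPre_exact N hf hg h i)
      (hD fun p hp ↦ hB p (Module.support_subset_of_surjective g hg hp))
      (hA fun p hp ↦ hB p (Module.support_subset_of_injective f hf hp))

/-- Nonvanishing of local Bass numbers moves up by one degree along a proper inclusion of
primes, up to passing to a larger prime. -/
lemma exists_mem_support_ext_succ [IsNoetherianRing R] [Module.Finite R N]
    {p q : PrimeSpectrum R} (hpq : p < q) {j : ℕ}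
    (hp : p ∈ Module.support R (ExtM R j (R ⧸ p.asIdeal) N)) :
    ∃ q₁ : PrimeSpectrum R, p < q₁ ∧ q₁ ≤ q ∧
      q₁ ∈ Module.support R (ExtM R (j + 1) (R ⧸ q₁.asIdeal) N) := by
  obtain ⟨x, hxq, hxp⟩ := SetLike.exists_of_lt (show p.asIdeal < q.asIdeal from hpq)
  have hle : p.asIdeal ⊔ Ideal.span {x} ≤ q.asIdeal :=
    sup_le hpq.le ((Ideal.span_singleton_le_iff_mem _).2 hxq)
  obtain ⟨I, hI, hIq⟩ := Ideal.exists_minimalPrimes_le hle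
  let q₁ : PrimeSpectrum R := ⟨I, hI.1.1⟩
  have hpq₁ : p ≤ q₁ := le_sup_left.trans hI.1.2
  have hxq₁ : x ∈ q₁.asIdeal := hI.1.2 (Ideal.mem_sup_right (Ideal.mem_span_singleton_self x))
  refine ⟨q₁, lt_of_le_of_ne hpq₁ fun h ↦ hxp (h ▸ hxq₁), hIq, ?_⟩
  refine mem_support_ext_quotient_prime (QuotSMulTop x (R ⧸ p.asIdeal)) (fun r hr hrq ↦ ?_) ?_
  · rw [Module.support_quotSMulTop, Module.support_eq_zeroLocus, Ideal.annihilator_quotient] at hr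
    refine le_antisymm hrq (hI.2 ⟨r.2, sup_le hr.1 ?_⟩ hrq)
    exact Ideal.span_le.2 hr.2
  · have hinj : Function.Injective (LinearMap.lsmul R (R ⧸ p.asIdeal) x) := by
      rw [← LinearMap.ker_eq_bot, LinearMap.ker_eq_bot']
      intro y hy
      rw [LinearMap.lsmul_apply, Algebra.smul_def, mul_eq_zero] at hy
      exact hy.resolve_left fun h ↦ hxp (Ideal.Quotient.eq_zero_iff_mem.1 h)
    obtain ⟨δ, h1, -⟩ := exists_extδ N hinj (Submodule.mkQ_surjective _)
      (LinearMap.exact_lsmul_mkQ_smul_top (R ⧸ p.asIdeal) x) j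
    have : Module.Finite R (ExtM R j (R ⧸ p.asIdeal) N) := ModuleCat.finite_ext R _ _ _
    have hmem : q₁ ∈ Module.support R (QuotSMulTop x (ExtM R j (R ⧸ p.asIdeal) N)) := by
      rw [Module.support_quotSMulTop]
      exact ⟨Module.mem_support_mono hpq₁ hp, by simpa using hxq₁⟩
    contrapose! hmem
    rw [Module.notMem_support_iff'] at hmem ⊢
    intro m
    obtain ⟨e, rfl⟩ := Submodule.mkQ_surjective _ m
    obtain ⟨r, hr, hre⟩ := hmem (δ e)
    obtain ⟨y, hy⟩ := (h1 (r • e)).1 (by rw [map_smul, hre])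
    rw [extPre_lsmul] at hy
    refine ⟨r, hr, ?_⟩
    rw [← map_smul, ← hy]
    exact (Submodule.Quotient.mk_eq_zero _).2 (Submodule.smul_mem_pointwise_smul _ _ _ trivial)

lemma exists_mem_support_ext_of_lt [IsNoetherianRing R] [Module.Finite R N]
    {q : PrimeSpectrum R} (p : PrimeSpectrum R) : ∀ (j : ℕ), p < q →
    p ∈ Module.support R (ExtM R j (R ⧸ p.asIdeal) N) →
    ∃ i, j < i ∧ q ∈ Module.support R (ExtM R i (R ⧸ q.asIdeal) N) := by
  have : WellFoundedGT (PrimeSpectrum R) := ⟨InvImage.wf PrimeSpectrum.asIdeal wellFounded_gt⟩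
  induction p using WellFoundedGT.induction with
  | ind p ih =>
    intro j hpq hp
    obtain ⟨q₁, h1, h2, h3⟩ := exists_mem_support_ext_succ hpq hp
    obtain rfl | h2 := h2.eq_or_lt
    · exact ⟨j + 1, j.lt_succ_self, h3⟩
    · obtain ⟨i, hi, hiq⟩ := ih q₁ h1 (j + 1) h2 h3
      exact ⟨i, by omega, hiq⟩

lemma mem_support_ext_zero_of_mem_associatedPrimes [IsNoetherianRing R] {p : PrimeSpectrum R}
    (hp : p.asIdeal ∈ associatedPrimes R N) :
    p ∈ Module.support R (ExtM R 0 (R ⧸ p.asIdeal) N) := by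
  obtain ⟨-, x, hx⟩ := isAssociatedPrime_iff.1 hp
  have hx' (r : R) : r ∈ p.asIdeal ↔ r • x = 0 := by
    rw [hx, Submodule.mem_colon_singleton, Submodule.mem_bot]
  let f : (R ⧸ p.asIdeal) →ₗ[R] N :=
    Submodule.liftQ p.asIdeal (LinearMap.toSpanSingleton R N x) fun r hr ↦ by
      simpa using (hx' r).1 hr
  rw [Module.mem_support_iff']
  refine ⟨Abelian.Ext.mk₀ (ModuleCat.ofHom f), fun r hr h ↦ hr ((hx' r).2 ?_)⟩
  have h0 : Abelian.Ext.mk₀ (ModuleCat.ofHom (f ∘ₗ LinearMap.lsmul R _ r)) =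
      Abelian.Ext.mk₀ 0 := by
    rw [← extPre_lsmul] at h
    simpa [extPre] using h
  have h1 := congrArg ModuleCat.Hom.hom (Abelian.Ext.addEquiv₀.symm.injective h0)
  have hf1 : f (Submodule.Quotient.mk 1) = x := (Submodule.liftQ_apply _ _ _).trans (by simp)
  have h2 : f (r • Submodule.Quotient.mk 1) = 0 :=
    LinearMap.congr_fun h1 (Submodule.Quotient.mk 1)
  rwa [map_smul, hf1] at h2

/-- A faithful finite module has a nonzero Ext against a residue domain in a degree at least the
Krull dimension. -/
lemma exists_not_subsingleton_ext [IsNoetherianRing R] [Module.Finite R N]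
    (hN : Module.annihilator R N = ⊥) {d : ℕ} (hd : d ≤ ringKrullDim R) :
    ∃ (q : PrimeSpectrum R) (i : ℕ), d ≤ i ∧ ¬ Subsingleton (ExtM R i (R ⧸ q.asIdeal) N) := by
  obtain ⟨l, hl⟩ := Order.le_krullDim_iff.1 hd
  have key (k : ℕ) (hk : k < l.length + 1) :
      ∃ i, k ≤ i ∧ l ⟨k, hk⟩ ∈ Module.support R (ExtM R i (R ⧸ (l ⟨k, hk⟩).asIdeal) N) := by
    induction k with
    | zero =>
      obtain ⟨I, hI, hIl⟩ := Ideal.exists_minimalPrimes_le (bot_le : ⊥ ≤ (l 0).asIdeal)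
      let p : PrimeSpectrum R := ⟨I, hI.1.1⟩
      have hp := mem_support_ext_zero_of_mem_associatedPrimes (N := N) (p := p)
        (Module.associatedPrimes.minimalPrimes_annihilator_subset_associatedPrimes R N
          (by rwa [hN]))
      obtain h | h := (show p ≤ l 0 from hIl).eq_or_lt
      · exact ⟨0, le_rfl, h ▸ hp⟩
      · obtain ⟨i, -, hi⟩ := exists_mem_support_ext_of_lt p 0 h hp
        exact ⟨i, i.zero_le, hi⟩
    | succ k ih =>
      obtain ⟨i, hi, hmem⟩ := ih (by omega)
      obtain ⟨i', hi', hmem'⟩ := exists_mem_support_ext_of_lt _ i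
        (l.strictMono (Fin.mk_lt_mk.2 k.lt_succ_self)) hmem
      exact ⟨i', by omega, hmem'⟩
  obtain ⟨i, hi, hmem⟩ := key d (by omega)
  refine ⟨l ⟨d, by omega⟩, i, hi, fun h ↦ ?_⟩
  rw [Module.support_eq_empty] at hmem
  exact hmem

lemma subsingleton_ext_residueField_of_lt_length [IsNoetherianRing R] [IsLocalRing R] {rs : List R}
    (hmem : ∀ r ∈ rs, r ∈ maximalIdeal R) (hrs : IsRegular R rs) {i : ℕ} (hi : i < rs.length) :
    Subsingleton (ExtM R i (R ⧸ maximalIdeal R) R) := by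
  refine ModuleCat.subsingleton_ext_of_exists_isRegular (maximalIdeal R)
    (ModuleCat.of R (R ⧸ maximalIdeal R)) ?_ (ModuleCat.of R R) ?_ rs hmem hrs i hi
  · change Module.support R (R ⧸ maximalIdeal R) ⊆ _
    rw [Module.support_eq_zeroLocus, Ideal.annihilator_quotient]
  · change (maximalIdeal R • ⊤ : Submodule R R) < ⊤
    rw [smul_eq_mul, Ideal.mul_top]
    exact lt_top_iff_ne_top.2 (maximalIdeal.isMaximal R).ne_top

/-- The length of a maximal regular sequence is detected by Ext from the residue field. -/
lemma not_subsingleton_ext_length [IsNoetherianRing R] [IsLocalRing R] {rs : List R}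
    (hmem : ∀ r ∈ rs, r ∈ maximalIdeal R) (hrs : IsRegular R rs)
    {f : (R ⧸ maximalIdeal R) →ₗ[R] (R ⧸ (Ideal.ofList rs • ⊤ : Submodule R R))}
    (hf : Function.Injective f) :
    ¬ Subsingleton (ExtM R rs.length (R ⧸ maximalIdeal R) R) := by
  intro h
  have key : ∀ (rs : List R) (Y : Type u) [AddCommGroup Y] [Module R Y], IsWeaklyRegular Y rs →
      (∀ i ≤ rs.length, Subsingleton (ExtM R i (R ⧸ maximalIdeal R) Y)) →
      Subsingleton (ExtM R 0 (R ⧸ maximalIdeal R) (Y ⧸ (Ideal.ofList rs • ⊤ : Submodule R Y))) := by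
    intro rs
    induction rs with
    | nil =>
      intro Y _ _ _ hE
      exact subsingleton_ext_of_linearEquiv_covariant (Submodule.quotEquivOfEqBot _ (by simp))
        (hE 0 le_rfl)
    | cons r rs ih =>
      intro Y _ _ hY hE
      rw [isWeaklyRegular_cons_iff] at hY
      refine subsingleton_ext_of_linearEquiv_covariant
        (Submodule.quotOfListConsSMulTopEquivQuotSMulTopInner Y r rs)
        (ih _ hY.2 fun i hi ↦ ?_)
      exact subsingleton_ext_covariant_right (f := LinearMap.lsmul R Y r)
        (g := (r • (⊤ : Submodule R Y)).mkQ) hY.1 (Submodule.mkQ_surjective _)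
        (LinearMap.exact_lsmul_mkQ_smul_top Y r) (hE i (by simp; omega))
        (hE (i + 1) (by simp; omega))
  have h0 := subsingleton_ext_zero_iff.1 (key rs R hrs.toIsWeaklyRegular fun i hi ↦
    hi.eq_or_lt.elim (fun h' ↦ h' ▸ h) (subsingleton_ext_residueField_of_lt_length hmem hrs))
  have : f = 0 := Subsingleton.elim _ _
  have hs : Subsingleton (R ⧸ maximalIdeal R) := subsingleton_of_forall_eq 0 fun x ↦
    hf (by simp [this])
  exact (maximalIdeal.isMaximal R).ne_top (Ideal.Quotient.subsingleton_iff.1 hs)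

end BassSupport

section Decomposition

open IsLocalRing RingTheory.Sequence

universe u

/-- A finite module with no Ext into `R` in degrees below the dimension is killed by a power of
the maximal ideal. -/
lemma exists_maximalIdeal_pow_le_annihilator {R : Type u} [CommRing R] [IsNoetherianRing R]
    [IsLocalRing R] {d : ℕ} (hd : ringKrullDim R = d) {K : Type u} [AddCommGroup K] [Module R K]
    [Module.Finite R K] (hK : ∀ i < d, Subsingleton (ExtM R i K R)) :
    ∃ n : ℕ, maximalIdeal R ^ n ≤ Module.annihilator R K := by
  by_cases htop : Module.annihilator R K = ⊤
  · exact ⟨0, by simp [htop]⟩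
  obtain ⟨rs, hlen, hmem, hrs⟩ := ModuleCat.exists_isRegular_of_exists_subsingleton_ext
    (Module.annihilator R K) d (ModuleCat.of R R)
    (by
      change (Module.annihilator R K • ⊤ : Submodule R R) < ⊤
      rw [smul_eq_mul, Ideal.mul_top]
      exact lt_top_iff_ne_top.2 htop)
    (ModuleCat.of R K) Module.support_eq_zeroLocus hK
  have hle : Ideal.ofList rs ≤ Module.annihilator R K := Ideal.span_le.2 hmem
  have hsum := ringKrullDim_add_length_eq_ringKrullDim_of_isRegular rs hrs
  have : Nontrivial (R ⧸ Ideal.ofList rs) :=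
    Ideal.Quotient.nontrivial_iff.2 fun h ↦ htop (top_le_iff.1 (h ▸ hle))
  have hdim : ringKrullDim (R ⧸ Ideal.ofList rs) = 0 := by
    rw [hd, hlen] at hsum
    generalize ringKrullDim (R ⧸ Ideal.ofList rs) = x at hsum
    induction x with
    | bot => simp at hsum
    | coe x =>
      induction x with
      | top =>
        have : (⊤ : ℕ∞) + d = d := by exact_mod_cast hsum
        simp at this
      | coe x =>
        have : x + d = d := by exact_mod_cast hsum
        have : x = 0 := by omega
        simp [this]
  have : IsArtinianRing (R ⧸ Ideal.ofList rs) := by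
    rw [isArtinianRing_iff_krullDimLE_zero]
    exact ringKrullDimZero_iff_ringKrullDim_eq_zero.2 hdim
  obtain ⟨n, hn⟩ := exists_maximalIdeal_pow_le_of_isArtinianRing_quotient (Ideal.ofList rs)
  exact ⟨n, hn.trans hle⟩

/-- The bidual of a module whose dual is finite free splits off, if evaluation is surjective. -/
lemma exists_equiv_ker_eval_prod {R : Type*} [CommRing R] [Nontrivial R] {M : Type*}
    [AddCommGroup M] [Module R M] [Module.Free R (Module.Dual R M)]
    [Module.Finite R (Module.Dual R M)]
    (h : Function.Surjective (Module.Dual.eval R M)) :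
    ∃ r : ℕ, ∃ e : M ≃ₗ[R] (LinearMap.ker (Module.Dual.eval R M) × (Fin r → R)),
      ∀ x : LinearMap.ker (Module.Dual.eval R M), e x = (x, 0) := by
  let b := Module.finBasis R (Module.Dual R (Module.Dual R M))
  obtain ⟨s, hs⟩ := Module.projective_lifting_property (Module.Dual.eval R M) .id h
  obtain ⟨e, he, -⟩ := (LinearMap.exact_subtype_ker_map (Module.Dual.eval R M)).splitSurjectiveEquiv
    (Submodule.subtype_injective _) ⟨s, hs⟩
  refine ⟨_, e.trans ((LinearEquiv.refl R _).prodCongr b.equivFun), fun x ↦ ?_⟩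
  have : e x = (x, 0) := by
    exact (e.symm_apply_eq.1 (LinearMap.congr_fun he x).symm).symm
  simp [this]

variable {R : Type} [CommRing R] [IsLocalRing R] {M : Type} [AddCommGroup M] [Module R M]

lemma le_mTorsion_of_pow_le_annihilator {K : Submodule R M} {n : ℕ}
    (h : maximalIdeal R ^ n ≤ Module.annihilator R K) : K ≤ mTorsion R M := by
  refine le_trans (fun x hx ↦ ?_) (le_iSup _ n)
  rw [Submodule.mem_torsionBySet_iff]
  exact fun a ↦ congrArg Subtype.val (Module.mem_annihilator.1 (h a.2) (⟨x, hx⟩ : K))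

lemma mTorsion_le_ker_eval {x : R} (hx : x ∈ maximalIdeal R) (hreg : IsSMulRegular R x) :
    mTorsion R M ≤ LinearMap.ker (Module.Dual.eval R M) := by
  refine iSup_le fun n y hy ↦ LinearMap.mem_ker.2 (LinearMap.ext fun ξ ↦ ?_)
  rw [Submodule.mem_torsionBySet_iff] at hy
  refine hreg.pow n ?_
  have := congrArg ξ (hy ⟨x ^ n, Ideal.pow_mem_pow hx n⟩)
  simpa using this

/-- A finite module whose evaluation map to its bidual is onto, with free dual and with no
intermediate Ext into `R`, splits as its `𝔪`-torsion plus a free module. -/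
lemma exists_equiv_mTorsion_prod [IsNoetherianRing R] [Module.Finite R M] {d : ℕ}
    (hd : ringKrullDim R = d) {rs : List R} (hmem : ∀ r ∈ rs, r ∈ maximalIdeal R)
    (hrs : IsWeaklyRegular R rs) (hlen : rs.length = d)
    (hM : ∀ j, 1 ≤ j → j ≤ d - 1 → Subsingleton (ExtM R j M R))
    [Module.Free R (Module.Dual R M)] (h : Function.Surjective (Module.Dual.eval R M)) :
    ∃ r : ℕ, Nonempty (M ≃ₗ[R] (mTorsion R M × (Fin r → R))) := by
  cases rs with
  | nil =>
    obtain rfl : 0 = d := hlen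
    obtain ⟨n, hn⟩ := exists_maximalIdeal_pow_le_annihilator hd (K := M) (by simp)
    have htop : mTorsion R M = ⊤ := top_le_iff.1 (le_mTorsion_of_pow_le_annihilator (n := n)
      (by rwa [Submodule.topEquiv.annihilator_eq]))
    exact ⟨0, ⟨Submodule.topEquiv.symm.trans ((LinearEquiv.ofEq _ _ htop.symm).trans
      LinearEquiv.prodUnique.symm)⟩⟩
  | cons x rs =>
    obtain ⟨r, e, he⟩ := exists_equiv_ker_eval_prod h
    let K := LinearMap.ker (Module.Dual.eval R M)
    let π : M →ₗ[R] K := LinearMap.fst R _ _ ∘ₗ e.toLinearMap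
    have hπ : π ∘ₗ K.subtype = .id := by
      ext1 x
      exact congrArg Prod.fst (he x)
    have hK0 : Subsingleton (K →ₗ[R] R) := by
      refine subsingleton_of_forall_eq 0 fun ξ ↦ LinearMap.ext fun k ↦ ?_
      have h1 : ξ (π k) = 0 := LinearMap.congr_fun (LinearMap.mem_ker.1 k.2) (ξ ∘ₗ π)
      have h2 := LinearMap.congr_fun hπ k
      have h3 : π k = k := h2
      rwa [h3] at h1
    have hK (i : ℕ) (hi : i < d) : Subsingleton (ExtM R i K R) := by
      obtain rfl | hi0 := i.eq_zero_or_pos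
      · exact subsingleton_ext_zero_iff.2 hK0
      · exact subsingleton_ext_of_retract K.subtype π hπ (hM i hi0 (by omega))
    obtain ⟨n, hn⟩ := exists_maximalIdeal_pow_le_annihilator hd hK
    have hKeq : K = mTorsion R M := le_antisymm (le_mTorsion_of_pow_le_annihilator hn)
      (mTorsion_le_ker_eval (hmem x (by simp)) ((isWeaklyRegular_cons_iff _ _ _).1 hrs).1)
    exact ⟨r, ⟨e.trans ((LinearEquiv.ofEq _ _ hKeq).prodCongr (LinearEquiv.refl R _))⟩⟩

end Decomposition

theorem cm_canonical_and_decomposition_of_finite_C_injdim_dual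
    (R : Type) [CommRing R] [IsNoetherianRing R] [IsLocalRing R]
    (d : ℕ) (hd : ringKrullDim R = d)
    (C : Type) [AddCommGroup C] [Module R C] [Module.Finite R C]
    (hC : IsSemidualizing R C)
    (M : Type) [AddCommGroup M] [Module R M] [Module.Finite R M] [Nontrivial M]
    (hextR : ∀ j : ℕ, 1 ≤ j → j ≤ d - 1 → Subsingleton (extMod R j M R))
    (hdual : Nontrivial (M →ₗ[R] R))
    (hCinj : HasFiniteInjDim R (TensorProduct R C (M →ₗ[R] R))) :
    moduleDepth R R = d ∧ HasFiniteInjDim R C ∧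
      ∃ r : ℕ, Nonempty (M ≃ₗ[R] (↥(mTorsion R M) × (Fin r → R))) := by
  obtain ⟨n, hn⟩ := hCinj
  have hCC (i : ℕ) : Subsingleton (ExtM R (i + 1) C C) :=
    subsingleton_extMod_iff.1 (hC.ext_vanish (i + 1) i.succ_pos)
  have : Nontrivial C := by
    by_contra h
    rw [not_nontrivial_iff_subsingleton] at h
    have := hC.bijective.1.subsingleton
    exact not_subsingleton R this
  have hM (j : ℕ) (h1 : 1 ≤ j) (h2 : j ≤ d - 1) : Subsingleton (ExtM R j M R) :=
    subsingleton_extMod_iff.1 (hextR j h1 h2)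
  obtain ⟨rs, hmem, hrs, hlen, f, hf⟩ := exists_isRegular_residueField_embedding hd
  have hfg (Y : Type) [AddCommGroup Y] [Module R Y] [Module.Finite R Y] (i : ℕ)
      (hi : rs.length < i) : Subsingleton (ExtM R i Y (TensorProduct R C (M →ₗ[R] R))) :=
    subsingleton_ext_of_length_lt
      (fun Y _ _ _ i hi ↦ subsingleton_extMod_iff.1 (hn Y i hi)) hrs hf Y hi
  obtain ⟨a, p, hp⟩ := Module.Finite.exists_fin' R M
  obtain ⟨σ, hσ⟩ := exists_retraction_lcomp hC.bijective hCC hM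
    (fun Y _ _ _ i hi ↦ hfg Y i (hlen.trans_lt hi)) p hp
  have : Module.Projective R (M →ₗ[R] R) := Module.Projective.of_split (p.lcomp R R) σ hσ
  have : Module.Free R (M →ₗ[R] R) := Module.free_of_flat_of_isLocalRing
  obtain ⟨s, r, hsr⟩ := exists_retract_tensor_of_free (R := R) C (X := M →ₗ[R] R)
  have hann : Module.annihilator R C = ⊥ := by
    refine (Submodule.eq_bot_iff _).2 fun r hr ↦ hC.bijective.1 (LinearMap.ext fun c ↦ ?_)
    simpa using Module.mem_annihilator.1 hr c
  obtain ⟨q, i, hi, hqi⟩ := exists_not_subsingleton_ext hann hd.ge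
  have hlen' : rs.length = d := by
    refine le_antisymm hlen (hi.trans (not_lt.1 fun h ↦ hqi ?_))
    exact subsingleton_ext_of_retract_covariant s r hsr (hfg _ i h)
  refine ⟨?_, ⟨n, fun Y _ _ i hi ↦ subsingleton_extMod_iff.2
    (subsingleton_ext_of_retract_covariant s r hsr (subsingleton_extMod_iff.1 (hn Y i hi)))⟩,
    exists_equiv_mTorsion_prod hd hmem hrs.toIsWeaklyRegular hlen' hM
      (Module.Dual.eval_surjective_of_retraction hσ)⟩
  have hset : IsLeast {i : ℕ | ¬ Subsingleton (extMod R i (R ⧸ IsLocalRing.maximalIdeal R) R)}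
      rs.length := by
    refine ⟨fun h ↦ not_subsingleton_ext_length hmem hrs hf (subsingleton_extMod_iff.1 h),
      fun i hi ↦ not_lt.1 fun hlt ↦ hi (subsingleton_extMod_iff.2
        (subsingleton_ext_residueField_of_lt_length hmem hrs hlt))⟩
  rw [← hlen']
  exact hset.csInf_eq
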